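/- Damour–Deser identity: for every spin-3 field h on ℝⁿ (n ≥ 1), the trace of the curvature tensor equals the antisymmetrized derivative of the Fronsdal tensor: η^{αβ} K_{αμ|βν|γρ}(x) = ∂_γ F_{μνρ}(x) − ∂_ρ F_{μνγ}(x) for all x ∈ ℝⁿ and all indices μ, ν, γ, ρ. -/

import Mathlib

open MeasureTheory

noncomputable section

/-- Mostly-plus Minkowski metric `η_{μν} = diag(−1,+1,…,+1)` on `ℝⁿ`
(it coincides with its inverse `η^{μν}`). -/
def eta (n : ℕ) (μ ν : Fin n) : ℝ :=
  if μ = ν then (if (μ : ℕ) = 0 then -1 else 1) else 0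

/-- Partial derivative `∂_μ` of a scalar function on `ℝⁿ`. -/
def pd {n : ℕ} (μ : Fin n) (f : (Fin n → ℝ) → ℝ) : (Fin n → ℝ) → ℝ :=
  fun x => fderiv ℝ f x (Pi.single μ 1)

/-- A rank-3 covariant tensor field on `ℝⁿ` (the type of spin-3 fields). -/
abbrev Spin3 (n : ℕ) := (Fin n → ℝ) → Fin n → Fin n → Fin n → ℝ

/-- Trace `h_μ := η^{νρ} h_{μνρ}`. -/
def trH {n : ℕ} (h : Spin3 n) (x : Fin n → ℝ) (μ : Fin n) : ℝ :=
  ∑ ν, ∑ ρ, eta n ν ρ * h x μ ν ρ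

/-- Fronsdal tensor
`F_{μνρ} := □h_{μνρ} − ∂^σ(∂_μ h_{νρσ} + ∂_ν h_{ρμσ} + ∂_ρ h_{μνσ})
  + ∂_μ∂_ν h_ρ + ∂_ν∂_ρ h_μ + ∂_ρ∂_μ h_ν`. -/
def fronsdal {n : ℕ} (h : Spin3 n) (x : Fin n → ℝ) (μ ν ρ : Fin n) : ℝ :=
  (∑ σ, ∑ τ, eta n σ τ * pd σ (pd τ (fun y => h y μ ν ρ)) x)
  - (∑ σ, ∑ τ, eta n σ τ *
      pd τ (fun y => pd μ (fun z => h z ν ρ σ) y + pd ν (fun z => h z ρ μ σ) y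
        + pd ρ (fun z => h z μ ν σ) y) x)
  + pd μ (pd ν (fun z => trH h z ρ)) x
  + pd ν (pd ρ (fun z => trH h z μ)) x
  + pd ρ (pd μ (fun z => trH h z ν)) x

/-- Trace of the Fronsdal tensor, `F_ρ := η^{μν} F_{μνρ}`. -/
def trF {n : ℕ} (h : Spin3 n) (x : Fin n → ℝ) (ρ : Fin n) : ℝ :=
  ∑ μ, ∑ ν, eta n μ ν * fronsdal h x μ ν ρ

/-- Einstein tensor `G_{μνρ} := F_{μνρ} − (1/2)(η_{μν}F_ρ + η_{νρ}F_μ + η_{ρμ}F_ν)`. -/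
def einstein {n : ℕ} (h : Spin3 n) (x : Fin n → ℝ) (μ ν ρ : Fin n) : ℝ :=
  fronsdal h x μ ν ρ
    - (1/2) * (eta n μ ν * trF h x ρ + eta n ν ρ * trF h x μ + eta n ρ μ * trF h x ν)

/-- Gauge transformation `(δ_λ h)_{μνρ} := ∂_μ λ_{νρ} + ∂_ν λ_{ρμ} + ∂_ρ λ_{μν}`. -/
def gaugeTransform {n : ℕ} (lam : (Fin n → ℝ) → Fin n → Fin n → ℝ) : Spin3 n :=
  fun x μ ν ρ => pd μ (fun y => lam y ν ρ) x + pd ν (fun y => lam y ρ μ) x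
    + pd ρ (fun y => lam y μ ν) x

/-- Curvature tensor `K_{αμ|βν|γρ}`: the antisymmetrization of `∂_α∂_β∂_γ h_{μνρ}`
in each of the index pairs `(α,μ)`, `(β,ν)`, `(γ,ρ)`. -/
def curvature {n : ℕ} (h : Spin3 n) (x : Fin n → ℝ) (α μ β ν γ ρ : Fin n) : ℝ :=
  pd α (pd β (pd γ (fun y => h y μ ν ρ))) x
  - pd μ (pd β (pd γ (fun y => h y α ν ρ))) x
  - pd α (pd ν (pd γ (fun y => h y μ β ρ))) x
  - pd α (pd β (pd ρ (fun y => h y μ ν γ))) x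
  + pd μ (pd ν (pd γ (fun y => h y α β ρ))) x
  + pd μ (pd β (pd ρ (fun y => h y α ν γ))) x
  + pd α (pd ν (pd ρ (fun y => h y μ β γ))) x
  - pd μ (pd ν (pd ρ (fun y => h y α β γ))) x

/-- The free Fronsdal Lagrangian density for a single spin-3 field (all
contractions performed with the Minkowski metric `η`). -/
def lag {n : ℕ} (h : Spin3 n) (x : Fin n → ℝ) : ℝ :=
  -(1/2) * (∑ σ, ∑ τ, ∑ μ, ∑ μ', ∑ ν, ∑ ν', ∑ ρ, ∑ ρ',
      eta n σ τ * eta n μ μ' * eta n ν ν' * eta n ρ ρ' *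
        pd σ (fun y => h y μ ν ρ) x * pd τ (fun y => h y μ' ν' ρ') x)
  + (3/2) * (∑ μ, ∑ μ', ∑ ν, ∑ ν', ∑ ρ, ∑ ρ', ∑ σ, ∑ σ',
      eta n μ μ' * eta n ν ν' * eta n ρ ρ' * eta n σ σ' *
        pd μ' (fun y => h y μ ρ σ) x * pd ν (fun y => h y ν' ρ' σ') x)
  + (3/2) * (∑ μ, ∑ μ', ∑ ν, ∑ ν',
      eta n μ μ' * eta n ν ν' * pd μ (fun y => trH h y ν) x * pd μ' (fun y => trH h y ν') x)
  + (3/4) * (∑ μ, ∑ μ', ∑ ν, ∑ ν',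
      eta n μ μ' * eta n ν ν' * pd μ (fun y => trH h y μ') x * pd ν (fun y => trH h y ν') x)
  - 3 * (∑ μ, ∑ μ', ∑ ν, ∑ ν', ∑ ρ, ∑ ρ',
      eta n μ μ' * eta n ν ν' * eta n ρ ρ' *
        pd μ (fun y => trH h y ν) x * pd ρ (fun y => h y ρ' μ' ν') x)

/-- The free spin-3 (Fronsdal) action for a single field. -/
def action {n : ℕ} (h : Spin3 n) : ℝ := ∫ x : Fin n → ℝ, lag h x

lemma sum_sum_eta_mul {n : ℕ} (f : Fin n → Fin n → ℝ) :
    ∑ σ, ∑ τ, eta n σ τ * f σ τ = ∑ σ, eta n σ σ * f σ σ := by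
  refine Finset.sum_congr rfl fun σ _ => Finset.sum_eq_single σ ?_ (by simp)
  intro τ _ hτ
  simp [eta, hτ.symm]

lemma contDiff_pd {n : ℕ} {f : (Fin n → ℝ) → ℝ} (hf : ContDiff ℝ (⊤ : ℕ∞) f) (μ : Fin n) :
    ContDiff ℝ (⊤ : ℕ∞) (pd μ f) :=
  (hf.fderiv_right (by simp)).clm_apply contDiff_const

lemma pd_add {n : ℕ} {f g : (Fin n → ℝ) → ℝ} (hf : ContDiff ℝ (⊤ : ℕ∞) f)
    (hg : ContDiff ℝ (⊤ : ℕ∞) g) (μ : Fin n) (x : Fin n → ℝ) :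
    pd μ (fun y => f y + g y) x = pd μ f x + pd μ g x := by
  simp only [pd]
  rw [fderiv_fun_add (hf.differentiable (by simp) x) (hg.differentiable (by simp) x)]
  rfl

lemma pd_sub {n : ℕ} {f g : (Fin n → ℝ) → ℝ} (hf : ContDiff ℝ (⊤ : ℕ∞) f)
    (hg : ContDiff ℝ (⊤ : ℕ∞) g) (μ : Fin n) (x : Fin n → ℝ) :
    pd μ (fun y => f y - g y) x = pd μ f x - pd μ g x := by
  simp only [pd]
  rw [fderiv_fun_sub (hf.differentiable (by simp) x) (hg.differentiable (by simp) x)]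
  rfl

lemma pd_sum_mul {n : ℕ} {ι : Type*} [Fintype ι] (c : ι → ℝ) {f : ι → (Fin n → ℝ) → ℝ}
    (hf : ∀ i, ContDiff ℝ (⊤ : ℕ∞) (f i)) (μ : Fin n) :
    pd μ (fun y => ∑ i, c i * f i y) = fun x => ∑ i, c i * pd μ (f i) x := by
  funext x
  have hd : ∀ i, DifferentiableAt ℝ (f i) x := fun i => (hf i).differentiable (by simp) x
  simp only [pd]
  rw [fderiv_fun_sum fun i _ => (hd i).const_mul (c i), sum_apply]
  refine Finset.sum_congr rfl fun i _ => ?_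
  rw [fderiv_const_mul (hd i)]
  rfl

lemma pd_comm {n : ℕ} {f : (Fin n → ℝ) → ℝ} (hf : ContDiff ℝ (⊤ : ℕ∞) f) (μ ν : Fin n) :
    pd μ (pd ν f) = pd ν (pd μ f) := by
  funext x
  have hd : DifferentiableAt ℝ (fderiv ℝ f) x :=
    (hf.fderiv_right (m := (⊤ : ℕ∞)) (by simp)).differentiable (by simp) x
  have key : ∀ α β : Fin n, pd α (pd β f) x =
      fderiv ℝ (fderiv ℝ f) x (Pi.single α 1) (Pi.single β 1) := by
    intro α β
    change fderiv ℝ (fun y => fderiv ℝ f y (Pi.single β 1)) x _ = _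
    rw [fderiv_clm_apply hd (differentiableAt_const _)]
    simp
  rw [key, key]
  exact (hf.contDiffAt.isSymmSndFDerivAt (by simpa using WithTop.coe_le_coe.2 (le_top (a := (2 : ℕ∞))))) _ _

/-- The Fronsdal tensor as a single contraction, using that `eta` is diagonal. -/
lemma fronsdal_eq_sum {n : ℕ} {h : Spin3 n}
    (hsmooth : ∀ μ ν ρ : Fin n, ContDiff ℝ (⊤ : ℕ∞) fun x => h x μ ν ρ)
    (x : Fin n → ℝ) (μ ν ρ : Fin n) :
    fronsdal h x μ ν ρ = ∑ σ, eta n σ σ *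
      (pd σ (pd σ (fun y => h y μ ν ρ)) x - pd σ (pd μ (fun y => h y ν ρ σ)) x
        - pd σ (pd ν (fun y => h y ρ μ σ)) x - pd σ (pd ρ (fun y => h y μ ν σ)) x
        + pd μ (pd ν (fun y => h y ρ σ σ)) x + pd ν (pd ρ (fun y => h y μ σ σ)) x
        + pd ρ (pd μ (fun y => h y ν σ σ)) x) := by
  have h₁ : ∀ α μ ν ρ, ContDiff ℝ (⊤ : ℕ∞) (pd α fun y => h y μ ν ρ) :=
    fun α μ ν ρ => contDiff_pd (hsmooth μ ν ρ) α
  have htr : ∀ α β κ, pd α (pd β fun z => trH h z κ) =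
      fun x => ∑ σ, eta n σ σ * pd α (pd β fun y => h y κ σ σ) x := by
    intro α β κ
    simp only [trH, sum_sum_eta_mul]
    rw [pd_sum_mul (f := fun σ y => h y κ σ σ) _ (fun σ => hsmooth κ σ σ) β,
      pd_sum_mul _ (fun σ => h₁ β κ σ σ) α]
  simp only [fronsdal, sum_sum_eta_mul, htr]
  rw [← Finset.sum_sub_distrib, ← Finset.sum_add_distrib, ← Finset.sum_add_distrib,
    ← Finset.sum_add_distrib]
  refine Finset.sum_congr rfl fun σ _ => ?_
  rw [pd_add ((h₁ _ _ _ _).add (h₁ _ _ _ _)) (h₁ _ _ _ _), pd_add (h₁ _ _ _ _) (h₁ _ _ _ _)]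
  ring

lemma pd_fronsdal {n : ℕ} {h : Spin3 n}
    (hsmooth : ∀ μ ν ρ : Fin n, ContDiff ℝ (⊤ : ℕ∞) fun x => h x μ ν ρ)
    (x : Fin n → ℝ) (γ μ ν ρ : Fin n) :
    pd γ (fun y => fronsdal h y μ ν ρ) x = ∑ σ, eta n σ σ *
      (pd γ (pd σ (pd σ (fun y => h y μ ν ρ))) x - pd γ (pd σ (pd μ (fun y => h y ν ρ σ))) x
        - pd γ (pd σ (pd ν (fun y => h y ρ μ σ))) x - pd γ (pd σ (pd ρ (fun y => h y μ ν σ))) x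
        + pd γ (pd μ (pd ν (fun y => h y ρ σ σ))) x + pd γ (pd ν (pd ρ (fun y => h y μ σ σ))) x
        + pd γ (pd ρ (pd μ (fun y => h y ν σ σ))) x) := by
  have h₂ : ∀ α β μ ν ρ, ContDiff ℝ (⊤ : ℕ∞) (pd α (pd β fun y => h y μ ν ρ)) :=
    fun α β μ ν ρ => contDiff_pd (contDiff_pd (hsmooth μ ν ρ) β) α
  simp only [fronsdal_eq_sum hsmooth]
  rw [pd_sum_mul]
  · refine Finset.sum_congr rfl fun σ _ => ?_
    congr 1
    rw [pd_add, pd_add, pd_add, pd_sub, pd_sub, pd_sub] <;>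
      repeat' first | exact h₂ _ _ _ _ _ | apply ContDiff.sub | apply ContDiff.add
  · intro σ
    repeat' first | exact h₂ _ _ _ _ _ | apply ContDiff.sub | apply ContDiff.add

/-- **Damour–Deser identity.**  For every spin-3 field `h` on `ℝⁿ` (`n ≥ 1`), the
trace of the curvature tensor equals the antisymmetrized derivative of the Fronsdal
tensor: `η^{αβ} K_{αμ|βν|γρ} = ∂_γ F_{μνρ} − ∂_ρ F_{μνγ}`. -/
theorem damour_deser_identity (n : ℕ) (hn : 1 ≤ n) (h : Spin3 n)
    (hsmooth : ∀ μ ν ρ : Fin n, ContDiff ℝ (⊤ : ℕ∞) fun x => h x μ ν ρ)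
    (hsym₁ : ∀ x μ ν ρ, h x μ ν ρ = h x ν μ ρ)
    (hsym₂ : ∀ x μ ν ρ, h x μ ν ρ = h x μ ρ ν) :
    ∀ (x : Fin n → ℝ) (μ ν γ ρ : Fin n),
      (∑ α, ∑ β, eta n α β * curvature h x α μ β ν γ ρ)
        = pd γ (fun y => fronsdal h y μ ν ρ) x - pd ρ (fun y => fronsdal h y μ ν γ) x := by
  intro x μ ν γ ρ
  rw [sum_sum_eta_mul (fun α β => curvature h x α μ β ν γ ρ), pd_fronsdal hsmooth,
    pd_fronsdal hsmooth, ← Finset.sum_sub_distrib]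
  refine Finset.sum_congr rfl fun σ _ => ?_
  rw [← mul_sub, curvature]
  congr 1
  obtain ⟨H, hH⟩ : ∃ H : Fin n → Fin n → Fin n → (Fin n → ℝ) → ℝ,
      ∀ i j k, (fun y => h y i j k) = H i j k := ⟨fun i j k y => h y i j k, fun _ _ _ => rfl⟩
  have s₁ : ∀ i j k, H i j k = H j i k := fun i j k => by
    rw [← hH, ← hH]; exact funext fun y => hsym₁ y i j k
  have s₂ : ∀ i j k, H i j k = H i k j := fun i j k => by
    rw [← hH, ← hH]; exact funext fun y => hsym₂ y i j k
  have hs : ∀ i j k, ContDiff ℝ (⊤ : ℕ∞) (H i j k) := fun i j k => hH i j k ▸ hsmooth i j k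
  have c₁ : ∀ a b i j k, pd a (pd b (H i j k)) = pd b (pd a (H i j k)) :=
    fun a b i j k => pd_comm (hs i j k) a b
  have c₂ : ∀ a b c i j k, pd a (pd b (pd c (H i j k))) = pd b (pd a (pd c (H i j k))) :=
    fun a b c i j k => pd_comm (contDiff_pd (hs i j k) c) a b
  simp only [hH, s₁, s₂, c₁, c₂]
  ring
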